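/- arXiv:1402.0651 — 2 statements merged into one kernel-verified Lean document; each statement's English description precedes it below -/
import Mathlib

section
/- For every N ≥ 2 and all complex numbers λ, μ, the creation operators of the algebraic Bethe ansatz commute: B_N(λ)·B_N(μ) = B_N(μ)·B_N(λ) as operators on 𝔥_N = (ℂ²)^⊗N. -/
open scoped TensorProduct

noncomputable section

namespace Heisenberg

/-- The state space `𝔥_N = (ℂ²)^⊗N`. -/
abbrev QState (N : ℕ) : Type := ⨂[ℂ] _i : Fin N, (Fin 2 → ℂ)

/-- The Pauli matrix `σ^x`. -/
def pauliX : Matrix (Fin 2) (Fin 2) ℂ := !![0, 1; 1, 0]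

/-- The Pauli matrix `σ^y`. -/
def pauliY : Matrix (Fin 2) (Fin 2) ℂ := !![0, -Complex.I; Complex.I, 0]

/-- The Pauli matrix `σ^z`. -/
def pauliZ : Matrix (Fin 2) (Fin 2) ℂ := !![1, 0; 0, -1]

/-- `σ^+ = σ^x + iσ^y`. -/
def pauliPlus : Matrix (Fin 2) (Fin 2) ℂ := pauliX + Complex.I • pauliY

/-- `σ^- = σ^x - iσ^y`. -/
def pauliMinus : Matrix (Fin 2) (Fin 2) ℂ := pauliX - Complex.I • pauliY

/-- `σ_k^a`: the operator acting as the 2×2 matrix `M` on the `k`-th tensor factor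
and as the identity elsewhere. -/
def siteOp (N : ℕ) (k : Fin N) (M : Matrix (Fin 2) (Fin 2) ℂ) :
    Module.End ℂ (QState N) :=
  PiTensorProduct.map (fun i => if i = k then Matrix.toLin' M else LinearMap.id)

/-- The Heisenberg Hamiltonian
`𝓗_N = (J/4)·∑_k (σ_k^x σ_{k+1}^x + σ_k^y σ_{k+1}^y + σ_k^z σ_{k+1}^z − Id)`
with periodic boundary conditions (the successor of `k` in `Fin N` is `finRotate N k`). -/
def ham (N : ℕ) (J : ℝ) : Module.End ℂ (QState N) :=
  ((J : ℂ) / 4) • ∑ k : Fin N,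
    (siteOp N k pauliX * siteOp N (finRotate N k) pauliX +
     siteOp N k pauliY * siteOp N (finRotate N k) pauliY +
     siteOp N k pauliZ * siteOp N (finRotate N k) pauliZ - 1)

/-- The total spin operator `S^a = (1/2)·∑_k σ_k^a`. -/
def spin (N : ℕ) (a : Matrix (Fin 2) (Fin 2) ℂ) : Module.End ℂ (QState N) :=
  ((1 : ℂ) / 2) • ∑ k : Fin N, siteOp N k a

/-- The Lax operator `L_k(λ)`, a 2×2 matrix with entries in `End(𝔥_N)`. -/
def lax (N : ℕ) (k : Fin N) (lam : ℂ) : Matrix (Fin 2) (Fin 2) (Module.End ℂ (QState N)) :=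
  !![lam • (1 : Module.End ℂ (QState N)) + (Complex.I / 2) • siteOp N k pauliZ,
       (Complex.I / 2) • siteOp N k pauliMinus;
     (Complex.I / 2) • siteOp N k pauliPlus,
       lam • (1 : Module.End ℂ (QState N)) - (Complex.I / 2) • siteOp N k pauliZ]

/-- The transfer matrix `T_N(λ) = L_N(λ)·L_{N−1}(λ)···L_1(λ)`. -/
def transfer (N : ℕ) (lam : ℂ) : Matrix (Fin 2) (Fin 2) (Module.End ℂ (QState N)) :=
  ((List.ofFn (fun k : Fin N => lax N k lam)).reverse).prod

/-- The creation operator `B_N(λ)`, the top-right entry of the transfer matrix. -/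
def Bop (N : ℕ) (lam : ℂ) : Module.End ℂ (QState N) := transfer N lam 0 1

/-- The `RTT` (Yang–Baxter) exchange relation with rational `R`-matrix `δ + iP`, entrywise. -/
def RTT {R : Type*} [Semiring R] [Algebra ℂ R] (δ : ℂ) (T T' : Matrix (Fin 2) (Fin 2) R) : Prop :=
  ∀ i j k l, δ • (T i j * T' k l) + Complex.I • (T k j * T' i l) =
    δ • (T' k l * T i j) + Complex.I • (T' k j * T i l)

/-- The exchange relation is preserved by products with mutually commuting entries. -/
lemma RTT.mul {R : Type*} [Semiring R] [Algebra ℂ R] {δ : ℂ} {A A' B B' : Matrix (Fin 2) (Fin 2) R}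
    (hA : RTT δ A A') (hB : RTT δ B B') (h : ∀ i j k l, Commute (B i j) (A' k l))
    (h' : ∀ i j k l, Commute (B' i j) (A k l)) : RTT δ (A * B) (A' * B') := by
  have expand : ∀ {A A' B B' : Matrix (Fin 2) (Fin 2) R},
      (∀ i j k l, Commute (B i j) (A' k l)) → ∀ i j k l,
      (A * B) i j * (A' * B') k l = ∑ m, ∑ n, (A i m * A' k n) * (B m j * B' n l) := by
    intro A A' B B' h i j k l
    simp only [Matrix.mul_apply, Finset.sum_mul_sum]
    refine Finset.sum_congr rfl fun m _ => Finset.sum_congr rfl fun n _ => ?_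
    rw [mul_assoc, ← mul_assoc (B m j), (h m j k n).eq]
    simp only [mul_assoc]
  intro i j k l
  rw [expand h, expand h, expand h', expand h']
  calc _ = ∑ m, ∑ n, (δ • (A i m * A' k n) + Complex.I • (A k m * A' i n)) *
          (B m j * B' n l) := by
        simp only [add_mul, smul_mul_assoc, Finset.sum_add_distrib, Finset.smul_sum]
    _ = ∑ m, ∑ n, (A' k n * A i m) *
          (δ • (B m j * B' n l) + Complex.I • (B n j * B' m l)) := by
        simp only [hA _ _ _ _, add_mul, mul_add, smul_mul_assoc, mul_smul_comm,
          Finset.sum_add_distrib]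
        exact congrArg _ Finset.sum_comm
    _ = _ := by
        simp only [hB _ _ _ _, mul_add, mul_smul_comm, Finset.sum_add_distrib, Finset.smul_sum]
        exact congrArg₂ _ Finset.sum_comm Finset.sum_comm

/-- The exchange relations in both orders make the entries with equal indices commute. -/
lemma RTT.commute {R : Type*} [Semiring R] [Algebra ℂ R] {δ : ℂ} {T T' : Matrix (Fin 2) (Fin 2) R}
    (h : RTT δ T T') (h' : RTT (-δ) T' T) (i j : Fin 2) : Commute (T i j) (T' i j) := by
  have h₁ := h i j i j
  have h₂ := h' i j i j
  simp only [← add_smul] at h₁ h₂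
  have hI : 2 * Complex.I = (δ + Complex.I) + (-δ + Complex.I) := by ring
  refine ((IsUnit.mk0 (2 * Complex.I) (by simp)).smul_left_cancel).mp ?_
  rw [hI, add_smul _ _ (T i j * T' i j), h₁, ← h₂, ← add_smul]

lemma commute_list_prod_apply {R n : Type*} [Semiring R] [Fintype n] [DecidableEq n] {x : R}
    {L : List (Matrix n n R)} (h : ∀ M ∈ L, ∀ i j, Commute x (M i j)) (i j : n) :
    Commute x (L.prod i j) := by
  induction L generalizing i j with
  | nil =>
    rw [List.prod_nil, Matrix.one_apply]
    split_ifs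
    exacts [Commute.one_right x, Commute.zero_right x]
  | cons M L ih =>
    rw [List.prod_cons, Matrix.mul_apply]
    exact Commute.sum_right _ _ _ fun m _ =>
      (h M List.mem_cons_self i m).mul_right
        (ih (fun M' hM' => h M' (List.mem_cons_of_mem _ hM')) m j)

lemma siteOp_eq_update (N : ℕ) (k : Fin N) (M : Matrix (Fin 2) (Fin 2) ℂ) :
    siteOp N k M =
      PiTensorProduct.map (Function.update (fun _ => LinearMap.id) k (Matrix.toLin' M)) := by
  unfold siteOp
  congr 1
  funext i
  by_cases h : i = k
  · subst h; simp
  · simp [h]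

lemma siteOp_add (N : ℕ) (k : Fin N) (M M' : Matrix (Fin 2) (Fin 2) ℂ) :
    siteOp N k (M + M') = siteOp N k M + siteOp N k M' := by
  simp only [siteOp_eq_update, map_add, PiTensorProduct.map_update_add]

lemma siteOp_smul (N : ℕ) (k : Fin N) (c : ℂ) (M : Matrix (Fin 2) (Fin 2) ℂ) :
    siteOp N k (c • M) = c • siteOp N k M := by
  simp only [siteOp_eq_update, map_smul, PiTensorProduct.map_update_smul]

lemma siteOp_sub (N : ℕ) (k : Fin N) (M M' : Matrix (Fin 2) (Fin 2) ℂ) :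
    siteOp N k (M - M') = siteOp N k M - siteOp N k M' := by
  have h := siteOp_add N k (M - M') M'
  rw [sub_add_cancel] at h
  refine LinearMap.ext fun v => ?_
  rw [h]
  exact (add_sub_cancel_right (siteOp N k (M - M') v) (siteOp N k M' v)).symm

lemma siteOp_one (N : ℕ) (k : Fin N) : siteOp N k 1 = 1 := by
  simp only [siteOp, Matrix.toLin'_one, ite_self]
  exact PiTensorProduct.map_id

lemma siteOp_mul (N : ℕ) (k : Fin N) (M M' : Matrix (Fin 2) (Fin 2) ℂ) :
    siteOp N k (M * M') = siteOp N k M * siteOp N k M' := by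
  unfold siteOp
  rw [← PiTensorProduct.map_mul]
  congr 1
  funext i
  split_ifs
  · exact Matrix.toLin'_mul M M'
  · rfl

lemma siteOp_commute (N : ℕ) {k k' : Fin N} (h : k ≠ k') (M M' : Matrix (Fin 2) (Fin 2) ℂ) :
    Commute (siteOp N k M) (siteOp N k' M') := by
  unfold siteOp
  rw [Commute, SemiconjBy, ← PiTensorProduct.map_mul, ← PiTensorProduct.map_mul]
  congr 1
  funext i
  by_cases hk : i = k
  · have hk' : i ≠ k' := hk ▸ h
    simp only [if_pos hk, if_neg hk']
    rfl
  · simp only [if_neg hk]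
    rfl

/-- The Lax operator of a single site, with 2×2 matrices as entries. -/
def siteLax (lam : ℂ) : Matrix (Fin 2) (Fin 2) (Matrix (Fin 2) (Fin 2) ℂ) :=
  !![!![lam + Complex.I / 2, 0; 0, lam - Complex.I / 2], !![0, 0; Complex.I, 0];
     !![0, Complex.I; 0, 0], !![lam - Complex.I / 2, 0; 0, lam + Complex.I / 2]]

lemma lax_apply (N : ℕ) (k : Fin N) (lam : ℂ) (i j : Fin 2) :
    lax N k lam i j = siteOp N k (siteLax lam i j) := by
  unfold lax
  simp only [← siteOp_one N k, ← siteOp_smul, ← siteOp_add, ← siteOp_sub]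
  fin_cases i <;> fin_cases j <;> refine congrArg (siteOp N k) ?_ <;> ext a b <;>
    fin_cases a <;> fin_cases b <;>
    simp [siteLax, pauliPlus, pauliMinus, pauliX, pauliY, pauliZ] <;> ring

lemma siteLax_rtt (lam mu : ℂ) : RTT (lam - mu) (siteLax lam) (siteLax mu) := by
  have hI : Complex.I * Complex.I = -1 := Complex.I_mul_I
  intro i j k l
  fin_cases i <;> fin_cases j <;> fin_cases k <;> fin_cases l <;>
    ext a b <;> fin_cases a <;> fin_cases b <;>
    simp [siteLax] <;> grind

lemma lax_rtt (N : ℕ) (k : Fin N) (lam mu : ℂ) :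
    RTT (lam - mu) (lax N k lam) (lax N k mu) := by
  intro i j k' l
  simp only [lax_apply, ← siteOp_mul, ← siteOp_smul, ← siteOp_add]
  rw [siteLax_rtt]

lemma lax_commute_list_prod (N : ℕ) (x y : ℂ) {a : Fin N} {L : List (Fin N)} (ha : a ∉ L)
    (i j k l : Fin 2) : Commute (lax N a y i j) ((L.map (lax N · x)).prod k l) := by
  refine commute_list_prod_apply (fun M hM k l => ?_) k l
  obtain ⟨b, hb, rfl⟩ := List.mem_map.mp hM
  rw [lax_apply, lax_apply]
  exact siteOp_commute N (ne_of_mem_of_not_mem hb ha).symm _ _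

lemma lax_list_prod_rtt (N : ℕ) (lam mu : ℂ) {L : List (Fin N)} (hL : L.Nodup) :
    RTT (lam - mu) (L.map (lax N · lam)).prod (L.map (lax N · mu)).prod := by
  induction L with
  | nil =>
    intro i j k l
    fin_cases i <;> fin_cases j <;> fin_cases k <;> fin_cases l <;> simp
  | cons a L ih =>
    obtain ⟨ha, hL⟩ := List.nodup_cons.mp hL
    simp only [List.map_cons, List.prod_cons]
    exact (lax_rtt N a lam mu).mul (ih hL)
      (fun i j k l => (lax_commute_list_prod N lam mu ha k l i j).symm)
      (fun i j k l => (lax_commute_list_prod N mu lam ha k l i j).symm)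

lemma transfer_rtt (N : ℕ) (lam mu : ℂ) :
    RTT (lam - mu) (transfer N lam) (transfer N mu) := by
  simp only [transfer, List.ofFn_eq_map, ← List.map_reverse]
  exact lax_list_prod_rtt N lam mu (List.nodup_reverse.mpr (List.nodup_finRange N))

/-- The creation operators of the algebraic Bethe ansatz commute:
`B_N(λ)·B_N(μ) = B_N(μ)·B_N(λ)`. -/
theorem Bop_comm (N : ℕ) (hN : 2 ≤ N) (lam mu : ℂ) :
    Bop N lam * Bop N mu = Bop N mu * Bop N lam := by
  exact (transfer_rtt N lam mu).commute ((neg_sub lam mu).symm ▸ transfer_rtt N mu lam) 0 1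

end Heisenberg
end
end

section
/- Let N ≥ 2 and let λ_1, …, λ_ℓ be pairwise distinct complex numbers satisfying the Bethe ansatz equations ((λ_k + i/2)/(λ_k − i/2))^N = ∏_{j ≠ k} (λ_k − λ_j + i)/(λ_k − λ_j − i) for k = 1, …, ℓ (in particular λ_k ≠ i/2 so that the left-hand sides are defined). Then the Bethe vector is a highest weight vector: S^+ Ψ_N(λ_1, …, λ_ℓ) = 0, where S^± = S^x ± iS^y. -/
open scoped TensorProduct

noncomputable section

namespace Heisenberg

/-- The reference state `|0⟩_N = v₊ ⊗ ⋯ ⊗ v₊` with all spins up. -/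
def vacuum (N : ℕ) : QState N :=
  PiTensorProduct.tprod ℂ (fun _ : Fin N => ![(1 : ℂ), 0])

/-- The Bethe vector `Ψ_N(λ_1, …, λ_ℓ) = B_N(λ_1)···B_N(λ_ℓ)|0⟩_N`. -/
def betheVec (N : ℕ) {ℓ : ℕ} (lam : Fin ℓ → ℂ) : QState N :=
  ((List.ofFn (fun j : Fin ℓ => Bop N (lam j))).prod) (vacuum N)

/-- `S^+ = S^x + iS^y`. -/
def spinPlus (N : ℕ) : Module.End ℂ (QState N) :=
  spin N pauliX + Complex.I • spin N pauliY

open Finset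

/-- The entrywise form of the Yang–Baxter exchange relation for a matrix with spectral parameter. -/
def ExchangeRel {R n : Type*} [Ring R] [Algebra ℂ R] (T : ℂ → Matrix n n R) : Prop :=
  ∀ x y i j k l, (x - y) • (T x i j * T y k l) + Complex.I • (T x k j * T y i l) =
    (x - y) • (T y k l * T x i j) + Complex.I • (T y k j * T x i l)

namespace ExchangeRel

variable {R n : Type*} [Ring R] [Algebra ℂ R]

theorem one [DecidableEq n] : ExchangeRel (fun _ => (1 : Matrix n n R)) := by
  intro x y i j k l
  have h (i j : n) (r : R) : Commute ((1 : Matrix n n R) i j) r := by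
    rw [Matrix.one_apply]; split_ifs
    · exact Commute.one_left r
    · exact Commute.zero_left r
  simp only [(h i j _).eq]

/-- Products of solutions of the exchange relation with commuting entries are solutions. -/
theorem mul [Fintype n] {L M : ℂ → Matrix n n R} (hL : ExchangeRel L) (hM : ExchangeRel M)
    (h : ∀ x y i j k l, Commute (L x i j) (M y k l)) :
    ExchangeRel (fun x => L x * M x) := by
  intro x y i j k l
  have e (x y : ℂ) (i j k l : n) : (L x * M x) i j * (L y * M y) k l =
      ∑ a, ∑ b, L x i a * L y k b * (M x a j * M y b l) := by
    simp only [Matrix.mul_apply, sum_mul_sum]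
    refine sum_congr rfl fun a _ => sum_congr rfl fun b _ => ?_
    rw [mul_assoc, mul_assoc, ← mul_assoc (M x a j), ← (h y x k b a j).eq, mul_assoc]
  have e₁ : (x - y) • ((L x * M x) i j * (L y * M y) k l) +
      Complex.I • ((L x * M x) k j * (L y * M y) i l) =
      ∑ a, ∑ b, ((x - y) • (L y k b * L x i a) + Complex.I • (L y k a * L x i b)) *
        (M x a j * M y b l) := by
    simp only [e, ← hL x y, smul_sum, ← sum_add_distrib, add_mul, smul_mul_assoc]
  have e₂ : (x - y) • ((L y * M y) k l * (L x * M x) i j) +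
      Complex.I • ((L y * M y) k j * (L x * M x) i l) =
      ∑ a, ∑ b, (L y k b * L x i a) * ((x - y) • (M x a j * M y b l) +
        Complex.I • (M x b j * M y a l)) := by
    simp only [hM x y, e]
    rw [sum_comm, sum_comm (f := fun a b => L y k a * L x i b * (M y a j * M x b l))]
    simp only [smul_sum, ← sum_add_distrib, mul_add, mul_smul_comm]
  rw [e₁, e₂]
  simp only [add_mul, mul_add, sum_add_distrib, smul_mul_assoc, mul_smul_comm]
  rw [sum_comm (f := fun a b => Complex.I • (L y k a * L x i b * (M x a j * M y b l)))]

variable {T : ℂ → Matrix (Fin 2) (Fin 2) R}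

theorem commute_B (hT : ExchangeRel T) (x y : ℂ) : Commute (T x 0 1) (T y 0 1) := by
  have key (x y : ℂ) (h : x - y + Complex.I ≠ 0) : Commute (T x 0 1) (T y 0 1) := by
    have := hT x y 0 1 0 1
    rw [← add_smul, ← add_smul] at this
    exact smul_right_injective R h this
  by_cases h : x - y + Complex.I = 0
  · refine (key y x fun h' => Complex.I_ne_zero ?_).symm
    linear_combination (h + h') / 2
  · exact key x y h

theorem A_mul_B (hT : ExchangeRel T) (x y : ℂ) : (x - y) • (T x 0 0 * T y 0 1) =
    (x - y - Complex.I) • (T y 0 1 * T x 0 0) + Complex.I • (T x 0 1 * T y 0 0) := by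
  have h := hT y x 0 1 0 0
  linear_combination (norm := module) h

theorem D_mul_B (hT : ExchangeRel T) (x y : ℂ) : (x - y) • (T x 1 1 * T y 0 1) =
    (x - y + Complex.I) • (T y 0 1 * T x 1 1) - Complex.I • (T x 0 1 * T y 1 1) := by
  have h := hT x y 1 1 0 1
  linear_combination (norm := module) h

end ExchangeRel

/-- Commuting creation operators `B`, together with an operator family `X` for which `v` is an
eigenvector and which is exchanged with `B` up to a coupling `c`: the action on `∏ B(λ_j) v`. -/
theorem exchange_apply {V ι : Type*} [AddCommGroup V] [Module ℂ V] [DecidableEq ι]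
    {B X : ℂ → Module.End ℂ V} {c : ℂ} {e : ℂ → ℂ} {lam : ι → ℂ} (hlam : Function.Injective lam)
    (hB : ∀ x y, Commute (B x) (B y))
    (hX : ∀ x y, (x - y) • (X x * B y) = (x - y - c) • (B y * X x) + c • (B x * X y))
    (Φ : Finset ι → V) (hΦ : ∀ m s, m ∉ s → Φ (insert m s) = B (lam m) (Φ s))
    (hv : ∀ x, X x (Φ ∅) = e x • Φ ∅) (s : Finset ι) :
    ∀ x, (∀ j ∈ s, x ≠ lam j) → X x (Φ s) =
      (e x * ∏ j ∈ s, (x - lam j - c) / (x - lam j)) • Φ s +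
      ∑ k ∈ s, (c / (x - lam k) * (e (lam k) *
        ∏ j ∈ s.erase k, (lam k - lam j - c) / (lam k - lam j))) • B x (Φ (s.erase k)) := by
  induction s using Finset.induction_on with
  | empty => intro x _; simp [hv]
  | insert m t hm ih =>
    intro x hx
    have hxm : x - lam m ≠ 0 := sub_ne_zero.2 (hx m (mem_insert_self m t))
    have hswap : X x (B (lam m) (Φ t)) = ((x - lam m - c) / (x - lam m)) • B (lam m) (X x (Φ t)) +
        (c / (x - lam m)) • B x (X (lam m) (Φ t)) := by
      have h := congrArg (fun f => (x - lam m)⁻¹ • f (Φ t)) (hX x (lam m))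
      simpa [smul_smul, inv_mul_cancel₀ hxm, div_eq_inv_mul] using h
    have hBB : ∀ w, B (lam m) (B x w) = B x (B (lam m) w) := fun w =>
      congrArg (fun f => f w) (hB (lam m) x).eq
    have hmt : ∀ j ∈ t, lam m ≠ lam j := fun j hj h => hm (hlam h ▸ hj)
    rw [hΦ m t hm, hswap, ih x fun j hj => hx j (mem_insert_of_mem hj), ih (lam m) hmt,
      prod_insert hm, sum_insert hm, erase_insert hm]
    simp only [map_add, map_smul, map_sum, smul_add, smul_sum, smul_smul, hBB]
    have hsum : ∀ k ∈ t, (c / (x - lam k) * (e (lam k) * ∏ j ∈ (insert m t).erase k,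
          (lam k - lam j - c) / (lam k - lam j))) • B x (Φ ((insert m t).erase k)) =
        ((x - lam m - c) / (x - lam m) * (c / (x - lam k) * (e (lam k) *
          ∏ j ∈ t.erase k, (lam k - lam j - c) / (lam k - lam j)))) •
            B x (B (lam m) (Φ (t.erase k))) +
        (c / (x - lam m) * (c / (lam m - lam k) * (e (lam k) *
          ∏ j ∈ t.erase k, (lam k - lam j - c) / (lam k - lam j)))) •
            B x (B (lam m) (Φ (t.erase k))) := by
      intro k hk
      have hmk : m ≠ k := fun h => hm (h ▸ hk)
      have hm' : m ∉ t.erase k := fun h => hm (mem_of_mem_erase h)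
      rw [erase_insert_of_ne hmk, prod_insert hm', hΦ m _ hm', ← add_smul]
      congr 1
      have h₁ : x - lam k ≠ 0 := sub_ne_zero.2 (hx k (mem_insert_of_mem hk))
      have h₂ : lam m - lam k ≠ 0 := sub_ne_zero.2 (hmt k hk)
      have h₃ : lam k - lam m ≠ 0 := sub_ne_zero.2 (hmt k hk).symm
      generalize ∏ j ∈ t.erase k, (lam k - lam j - c) / (lam k - lam j) = P
      rw [show lam k - lam m = -(lam m - lam k) by ring]
      field_simp
      ring
    rw [sum_congr rfl hsum, sum_add_distrib, mul_left_comm]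
    abel

/-- The action of a raising operator `S` with `[S, B] = A - D` on `∏ B(λ_j) v`. -/
theorem raising_apply {V ι : Type*} [AddCommGroup V] [Module ℂ V] [DecidableEq ι]
    {A B D : ℂ → Module.End ℂ V} {S : Module.End ℂ V} {c : ℂ} {a d : ℂ → ℂ} {lam : ι → ℂ}
    (hlam : Function.Injective lam) (hB : ∀ x y, Commute (B x) (B y))
    (hA : ∀ x y, (x - y) • (A x * B y) = (x - y - c) • (B y * A x) + c • (B x * A y))
    (hD : ∀ x y, (x - y) • (D x * B y) = (x - y + c) • (B y * D x) - c • (B x * D y))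
    (hS : ∀ x, S * B x = B x * S + (A x - D x))
    (Φ : Finset ι → V) (hΦ : ∀ m s, m ∉ s → Φ (insert m s) = B (lam m) (Φ s))
    (ha : ∀ x, A x (Φ ∅) = a x • Φ ∅) (hd : ∀ x, D x (Φ ∅) = d x • Φ ∅) (hS₀ : S (Φ ∅) = 0)
    (s : Finset ι) :
    S (Φ s) = ∑ k ∈ s, (a (lam k) * ∏ j ∈ s.erase k, (lam k - lam j - c) / (lam k - lam j) -
      d (lam k) * ∏ j ∈ s.erase k, (lam k - lam j + c) / (lam k - lam j)) • Φ (s.erase k) := by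
  induction s using Finset.induction_on with
  | empty => simp [hS₀]
  | insert m t hm ih =>
    have hmt : ∀ j ∈ t, lam m ≠ lam j := fun j hj h => hm (hlam h ▸ hj)
    have hS' : S (B (lam m) (Φ t)) = B (lam m) (S (Φ t)) + (A (lam m) (Φ t) - D (lam m) (Φ t)) :=
      congrArg (fun f => f (Φ t)) (hS (lam m))
    have hD' : ∀ x y, (x - y) • (D x * B y) =
        (x - y - -c) • (B y * D x) + (-c) • (B x * D y) := fun x y => by
      rw [hD, sub_neg_eq_add, neg_smul, sub_eq_add_neg]
    rw [hΦ m t hm, hS', ih, exchange_apply hlam hB hA Φ hΦ ha t _ hmt,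
      exchange_apply hlam hB hD' Φ hΦ hd t _ hmt, sum_insert hm, erase_insert hm]
    simp only [map_smul, map_sum, sub_neg_eq_add]
    have hsum : ∀ k ∈ t, (a (lam k) *
          ∏ j ∈ (insert m t).erase k, (lam k - lam j - c) / (lam k - lam j) -
        d (lam k) * ∏ j ∈ (insert m t).erase k, (lam k - lam j + c) / (lam k - lam j)) •
          Φ ((insert m t).erase k) =
        (a (lam k) * ∏ j ∈ t.erase k, (lam k - lam j - c) / (lam k - lam j) -
          d (lam k) * ∏ j ∈ t.erase k, (lam k - lam j + c) / (lam k - lam j)) •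
            B (lam m) (Φ (t.erase k)) +
        ((c / (lam m - lam k) * (a (lam k) *
          ∏ j ∈ t.erase k, (lam k - lam j - c) / (lam k - lam j))) •
            B (lam m) (Φ (t.erase k)) -
        (-c / (lam m - lam k) * (d (lam k) *
          ∏ j ∈ t.erase k, (lam k - lam j + c) / (lam k - lam j))) •
            B (lam m) (Φ (t.erase k))) := by
      intro k hk
      have hmk : m ≠ k := fun h => hm (h ▸ hk)
      have hm' : m ∉ t.erase k := fun h => hm (mem_of_mem_erase h)
      rw [erase_insert_of_ne hmk, prod_insert hm', prod_insert hm', hΦ m _ hm', ← sub_smul,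
        ← add_smul]
      congr 1
      have h₂ : lam m - lam k ≠ 0 := sub_ne_zero.2 (hmt k hk)
      rw [show lam k - lam m = -(lam m - lam k) by ring]
      field_simp
      ring
    rw [sum_congr rfl hsum, sum_add_distrib, sum_sub_distrib, sub_smul]
    abel

/-- The entries of the Lax operator as single-site matrices. -/
def laxEntry (x : ℂ) (i j : Fin 2) : Matrix (Fin 2) (Fin 2) ℂ :=
  (if i = j then x - Complex.I / 2 else 0) • 1 + Complex.I • Matrix.single j i 1

theorem exchangeRel_laxEntry (x y : ℂ) (i j k l : Fin 2) :
    (x - y) • (laxEntry x i j * laxEntry y k l) +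
      Complex.I • (laxEntry x k j * laxEntry y i l) =
    (x - y) • (laxEntry y k l * laxEntry x i j) +
      Complex.I • (laxEntry y k j * laxEntry x i l) := by
  ext a b
  fin_cases i <;> fin_cases j <;> fin_cases k <;> fin_cases l <;> fin_cases a <;> fin_cases b <;>
    simp [laxEntry, Matrix.mul_apply, Matrix.single_apply, -mul_eq_mul_left_iff] <;>
    first
    | ring1
    | linear_combination (x - y) * Complex.I_sq
    | linear_combination (y - x) * Complex.I_sq

theorem single_mul_laxEntry (x : ℂ) (i j : Fin 2) :
    Matrix.single 0 1 1 * laxEntry x i j - laxEntry x i j * Matrix.single 0 1 1 =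
      (if j = 1 then laxEntry x i 0 else 0) - (if i = 0 then laxEntry x 1 j else 0) := by
  ext a b
  fin_cases i <;> fin_cases j <;> fin_cases a <;> fin_cases b <;>
    simp [laxEntry, Matrix.mul_apply, Matrix.one_apply, Matrix.single_apply]

section LocalLax

variable {R : Type*} [Ring R] [Algebra ℂ R] {ι : Type*}

/-- The Lax operator of a copy of the `2 × 2` matrices inside an algebra. -/
def localLax (φ : Matrix (Fin 2) (Fin 2) ℂ →ₐ[ℂ] R) (x : ℂ) : Matrix (Fin 2) (Fin 2) R :=
  Matrix.of fun i j => φ (laxEntry x i j)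

/-- The ordered product of the Lax operators along a list of sites. -/
def localTransfer (φ : ι → Matrix (Fin 2) (Fin 2) ℂ →ₐ[ℂ] R) (l : List ι) (x : ℂ) :
    Matrix (Fin 2) (Fin 2) R :=
  (l.map fun k => localLax (φ k) x).prod

theorem localLax_apply (φ : Matrix (Fin 2) (Fin 2) ℂ →ₐ[ℂ] R) (x : ℂ) (i j : Fin 2) :
    localLax φ x i j = φ (laxEntry x i j) := rfl

theorem localTransfer_nil (φ : ι → Matrix (Fin 2) (Fin 2) ℂ →ₐ[ℂ] R) (x : ℂ) :
    localTransfer φ [] x = 1 := rfl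

theorem localTransfer_cons (φ : ι → Matrix (Fin 2) (Fin 2) ℂ →ₐ[ℂ] R) (k : ι) (l : List ι)
    (x : ℂ) : localTransfer φ (k :: l) x = localLax (φ k) x * localTransfer φ l x := by
  simp only [localTransfer, List.map_cons, List.prod_cons]

theorem exchangeRel_localLax (φ : Matrix (Fin 2) (Fin 2) ℂ →ₐ[ℂ] R) :
    ExchangeRel (localLax φ) := by
  intro x y i j k l
  simp only [localLax_apply, ← map_mul, ← map_smul, ← map_add]
  exact congrArg φ (exchangeRel_laxEntry x y i j k l)

theorem commute_localTransfer {φ : ι → Matrix (Fin 2) (Fin 2) ℂ →ₐ[ℂ] R} {r : R} {l : List ι}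
    (h : ∀ k ∈ l, ∀ M, Commute r (φ k M)) (x : ℂ) (i j : Fin 2) :
    Commute r (localTransfer φ l x i j) := by
  induction l generalizing i j with
  | nil =>
    rw [localTransfer_nil, Matrix.one_apply]
    split_ifs
    · exact Commute.one_right r
    · exact Commute.zero_right r
  | cons k l ih =>
    rw [localTransfer_cons, Matrix.mul_apply]
    exact Commute.sum_right _ _ _ fun a _ => (h k List.mem_cons_self _).mul_right
      (ih (fun k' hk' => h k' (List.mem_cons_of_mem k hk')) a j)

theorem exchangeRel_localTransfer {φ : ι → Matrix (Fin 2) (Fin 2) ℂ →ₐ[ℂ] R}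
    (hφ : ∀ k l, k ≠ l → ∀ M M', Commute (φ k M) (φ l M')) {l : List ι} (hl : l.Nodup) :
    ExchangeRel (localTransfer φ l) := by
  induction l with
  | nil => exact ExchangeRel.one
  | cons k l ih =>
    rw [List.nodup_cons] at hl
    simp only [funext (localTransfer_cons φ k l)]
    exact (exchangeRel_localLax (φ k)).mul (ih hl.2) fun x y i j p q =>
      commute_localTransfer (fun k' hk' M => hφ k k' (fun h => hl.1 (h ▸ hk')) _ M) y p q

variable [Fintype ι]

theorem raising_mul_localLax {φ : ι → Matrix (Fin 2) (Fin 2) ℂ →ₐ[ℂ] R}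
    (hφ : ∀ k l, k ≠ l → ∀ M M', Commute (φ k M) (φ l M')) (k : ι) (x : ℂ) (i j : Fin 2) :
    (∑ l, φ l (Matrix.single 0 1 1)) * localLax (φ k) x i j -
        localLax (φ k) x i j * ∑ l, φ l (Matrix.single 0 1 1) =
      (if j = 1 then localLax (φ k) x i 0 else 0) -
        (if i = 0 then localLax (φ k) x 1 j else 0) := by
  simp only [localLax_apply]
  have h := congrArg (φ k) (single_mul_laxEntry x i j)
  rw [map_sub, map_sub, map_mul, map_mul, apply_ite (φ k), apply_ite (φ k), map_zero] at h
  rw [← h, sum_mul, mul_sum, ← sum_sub_distrib]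
  refine sum_eq_single k (fun l _ hl => ?_) (by simp)
  rw [(hφ l k hl _ _).eq, sub_self]

theorem raising_mul_localTransfer {φ : ι → Matrix (Fin 2) (Fin 2) ℂ →ₐ[ℂ] R}
    (hφ : ∀ k l, k ≠ l → ∀ M M', Commute (φ k M) (φ l M')) (l : List ι) (x : ℂ) (i j : Fin 2) :
    (∑ k, φ k (Matrix.single 0 1 1)) * localTransfer φ l x i j -
        localTransfer φ l x i j * ∑ k, φ k (Matrix.single 0 1 1) =
      (if j = 1 then localTransfer φ l x i 0 else 0) -
        (if i = 0 then localTransfer φ l x 1 j else 0) := by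
  induction l generalizing i j with
  | nil => fin_cases i <;> fin_cases j <;> simp [localTransfer_nil]
  | cons k l ih =>
    have hS := raising_mul_localLax hφ k x
    simp only [localTransfer_cons, Matrix.mul_apply, Fin.sum_univ_two]
    generalize localTransfer φ l x = P at ih ⊢
    generalize localLax (φ k) x = L at hS ⊢
    generalize ∑ k, φ k (Matrix.single 0 1 1) = S at ih hS ⊢
    have e (a : Fin 2) : S * (L i a * P a j) - L i a * P a j * S =
        (S * L i a - L i a * S) * P a j + L i a * (S * P a j - P a j * S) := by
      simp only [sub_mul, mul_sub, mul_assoc]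
      abel
    rw [mul_add, add_mul, add_sub_add_comm, e, e, hS, hS, ih, ih]
    fin_cases i <;> fin_cases j <;> simp <;> noncomm_ring

end LocalLax

section Vacuum

variable {V ι : Type*} [AddCommGroup V] [Module ℂ V]
  {φ : ι → Matrix (Fin 2) (Fin 2) ℂ →ₐ[ℂ] Module.End ℂ V} {v : V}

theorem localLax_vacuum {φ : Matrix (Fin 2) (Fin 2) ℂ →ₐ[ℂ] Module.End ℂ V}
    (hv : ∀ M (c : ℂ), M.mulVec ![1, 0] = c • ![1, 0] → φ M v = c • v) (x : ℂ) :
    localLax φ x 0 0 v = (x + Complex.I / 2) • v ∧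
    localLax φ x 1 1 v = (x - Complex.I / 2) • v ∧ localLax φ x 1 0 v = 0 := by
  refine ⟨hv _ _ ?_, hv _ _ ?_, (hv _ 0 ?_).trans (zero_smul _ _)⟩ <;>
  · ext i
    fin_cases i <;>
      simp [laxEntry, Matrix.mulVec, dotProduct, Matrix.single_apply] <;> ring

theorem localTransfer_vacuum (hφ : ∀ k l, k ≠ l → ∀ M M', Commute (φ k M) (φ l M'))
    (hv : ∀ k M (c : ℂ), M.mulVec ![1, 0] = c • ![1, 0] → φ k M v = c • v) {l : List ι}
    (hl : l.Nodup) (x : ℂ) :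
    localTransfer φ l x 0 0 v = (x + Complex.I / 2) ^ l.length • v ∧
    localTransfer φ l x 1 1 v = (x - Complex.I / 2) ^ l.length • v ∧
    localTransfer φ l x 1 0 v = 0 := by
  induction l with
  | nil => simp [localTransfer_nil]
  | cons k l ih =>
    rw [List.nodup_cons] at hl
    obtain ⟨h₀, h₁, h₂⟩ := ih hl.2
    obtain ⟨k₀, k₁, k₂⟩ := localLax_vacuum (hv k) x
    have hc : localLax (φ k) x 1 0 (localTransfer φ l x 0 1 v) = 0 := by
      have h : Commute (localLax (φ k) x 1 0) (localTransfer φ l x 0 1) :=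
        commute_localTransfer (fun k' hk' M => hφ k k' (fun h => hl.1 (h ▸ hk')) _ M) x 0 1
      rw [← Module.End.mul_apply, h.eq, Module.End.mul_apply, k₂, map_zero]
    simp only [localTransfer_cons, Matrix.mul_apply, Fin.sum_univ_two,
      LinearMap.add_apply, Module.End.mul_apply, h₀, h₁, h₂, hc, k₀, k₁, k₂, map_smul, map_zero,
      smul_zero, add_zero, zero_add, smul_smul, List.length_cons, pow_succ, and_self]

/-- The Bethe equations for distinct roots never involve a vanishing denominator on the right. -/
theorem sub_ne_I_of_bethe {N ℓ : ℕ} (hN : N ≠ 0) {lam : Fin ℓ → ℂ}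
    (hdist : Function.Injective lam) (hreg : ∀ k, lam k ≠ Complex.I / 2)
    (hBAE : ∀ k, ((lam k + Complex.I / 2) / (lam k - Complex.I / 2)) ^ N =
      ∏ j ∈ Finset.univ.erase k,
        (lam k - lam j + Complex.I) / (lam k - lam j - Complex.I)) (k j : Fin ℓ) :
    lam k - lam j - Complex.I ≠ 0 := by
  intro h
  have hkj : k ≠ j := by
    rintro rfl
    simp at h
  have key (p q : Fin ℓ) (hpq : q ≠ p)
      (h : (lam p - lam q + Complex.I) / (lam p - lam q - Complex.I) = 0) :
      lam p + Complex.I / 2 = 0 := by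
    have h' := (hBAE p).trans (prod_eq_zero (mem_erase.2 ⟨hpq, mem_univ q⟩) h)
    exact (div_eq_zero_iff.1 (pow_eq_zero_iff hN |>.1 h')).resolve_right
      (sub_ne_zero.2 (hreg p))
  have hk := key k j hkj.symm (by rw [h, div_zero])
  have hj := key j k hkj (by
    rw [show lam j - lam k + Complex.I = 0 by linear_combination -h, zero_div])
  exact hkj (hdist (by linear_combination hk - hj))

/-- Bethe vectors built from pairwise commuting copies of the `2 × 2` matrices and a common
highest weight vector `v` are annihilated by the total raising operator. -/
theorem raising_betheVec_eq_zero [Fintype ι]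
    (hφ : ∀ k l, k ≠ l → ∀ M M', Commute (φ k M) (φ l M'))
    (hv : ∀ k M (c : ℂ), M.mulVec ![1, 0] = c • ![1, 0] → φ k M v = c • v) {l : List ι}
    (hl : l.Nodup) (hN : l.length ≠ 0) {ℓ : ℕ} {lam : Fin ℓ → ℂ}
    (hdist : Function.Injective lam) (hreg : ∀ k, lam k ≠ Complex.I / 2)
    (hBAE : ∀ k, ((lam k + Complex.I / 2) / (lam k - Complex.I / 2)) ^ l.length =
      ∏ j ∈ Finset.univ.erase k,
        (lam k - lam j + Complex.I) / (lam k - lam j - Complex.I)) :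
    (∑ k, φ k (Matrix.single 0 1 1))
      ((List.ofFn fun j : Fin ℓ => localTransfer φ l (lam j) 0 1).prod v) = 0 := by
  have hT := exchangeRel_localTransfer hφ hl
  have hB (x y : ℂ) : Commute (localTransfer φ l x 0 1) (localTransfer φ l y 0 1) :=
    hT.commute_B x y
  let Φ (s : Finset (Fin ℓ)) : V :=
    s.noncommProd (fun j => localTransfer φ l (lam j) 0 1) (fun _ _ _ _ _ => hB _ _) v
  have hΦ (m : Fin ℓ) (s : Finset (Fin ℓ)) (hm : m ∉ s) :
      Φ (insert m s) = localTransfer φ l (lam m) 0 1 (Φ s) :=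
    LinearMap.congr_fun (noncommProd_insert_of_notMem s m _ _ hm) v
  have hΦ₀ : Φ ∅ = v := LinearMap.congr_fun (noncommProd_empty _ _) v
  have hΦ₁ : (List.ofFn fun j : Fin ℓ => localTransfer φ l (lam j) 0 1).prod v = Φ univ := by
    simp only [Φ, noncommProd, Fin.univ_val_map, Multiset.noncommProd_coe]
  have hS (x : ℂ) := sub_eq_iff_eq_add'.1 (raising_mul_localTransfer hφ l x 0 1)
  simp only [if_true] at hS
  have hS₀ : (∑ k, φ k (Matrix.single 0 1 1)) v = 0 := by
    rw [LinearMap.sum_apply]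
    refine sum_eq_zero fun k _ => (hv k _ 0 ?_).trans (zero_smul _ _)
    ext i
    fin_cases i <;> simp [Matrix.mulVec, dotProduct, Matrix.single_apply]
  rw [hΦ₁, raising_apply hdist hB hT.A_mul_B hT.D_mul_B hS Φ hΦ
    (a := fun x => (x + Complex.I / 2) ^ l.length) (d := fun x => (x - Complex.I / 2) ^ l.length)
    (by rw [hΦ₀]; exact fun x => (localTransfer_vacuum hφ hv hl x).1)
    (by rw [hΦ₀]; exact fun x => (localTransfer_vacuum hφ hv hl x).2.1) (by rw [hΦ₀, hS₀])]
  refine sum_eq_zero fun k _ => ?_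
  have hden := prod_ne_zero_iff.2 fun j (_ : j ∈ univ.erase k) =>
    sub_ne_I_of_bethe hN hdist hreg hBAE k j
  have h := hBAE k
  rw [div_pow, prod_div_distrib, div_eq_div_iff (pow_ne_zero _ (sub_ne_zero.2 (hreg k))) hden] at h
  simp only [prod_div_distrib]
  rw [mul_div_assoc', mul_div_assoc', h, mul_comm, sub_self, zero_smul]

end Vacuum

/-- `siteOp` as an algebra homomorphism in the matrix. -/
def siteHom (N : ℕ) (k : Fin N) : Matrix (Fin 2) (Fin 2) ℂ →ₐ[ℂ] Module.End ℂ (QState N) :=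
  have h (M : Matrix (Fin 2) (Fin 2) ℂ) : siteOp N k M = PiTensorProduct.map
      (Function.update (fun _ : Fin N => (LinearMap.id : (Fin 2 → ℂ) →ₗ[ℂ] (Fin 2 → ℂ))) k
        (Matrix.toLin' M)) := by
    unfold siteOp
    congr 1
    ext i : 1
    simp [Function.update_apply]
  AlgHom.ofLinearMap
    { toFun := siteOp N k
      map_add' := fun M M' => by simp only [h, map_add, PiTensorProduct.map_update_add]
      map_smul' := fun c M => by
        simp only [h, map_smul, PiTensorProduct.map_update_smul, RingHom.id_apply] }
    (by
      simp only [LinearMap.coe_mk, AddHom.coe_mk, siteOp, Matrix.toLin'_one, ite_self]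
      exact PiTensorProduct.map_one)
    (fun M M' => by
      simp only [LinearMap.coe_mk, AddHom.coe_mk, siteOp, ← PiTensorProduct.map_mul]
      congr 1
      ext i : 1
      split_ifs
      · exact Matrix.toLin'_mul M M'
      · rfl)

theorem siteHom_apply (N : ℕ) (k : Fin N) (M : Matrix (Fin 2) (Fin 2) ℂ) :
    siteHom N k M = siteOp N k M := rfl

theorem commute_siteHom {N : ℕ} {k l : Fin N} (h : k ≠ l) (M M' : Matrix (Fin 2) (Fin 2) ℂ) :
    Commute (siteHom N k M) (siteHom N l M') := by
  simp only [Commute, SemiconjBy, siteHom_apply, siteOp, ← PiTensorProduct.map_mul]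
  congr 1
  ext i : 1
  by_cases hk : i = k
  · have : i ≠ l := hk ▸ h
    simp only [if_pos hk, if_neg this]; rfl
  · simp only [if_neg hk]; rfl

theorem siteHom_vacuum {N : ℕ} (k : Fin N) (M : Matrix (Fin 2) (Fin 2) ℂ) (c : ℂ)
    (hM : M.mulVec ![1, 0] = c • ![1, 0]) :
    siteHom N k M (vacuum N) = c • vacuum N := by
  have h : (fun i => (if i = k then Matrix.toLin' M else LinearMap.id) ![(1 : ℂ), 0]) =
      Function.update (fun _ : Fin N => ![(1 : ℂ), 0]) k (c • ![1, 0]) := by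
    ext i : 1
    by_cases hi : i = k
    · subst hi; simp [hM]
    · simp [hi]
  rw [siteHom_apply, siteOp, vacuum, PiTensorProduct.map_tprod, h, MultilinearMap.map_update_smul,
    Function.update_eq_self]

theorem lax_eq (N : ℕ) (k : Fin N) (x : ℂ) : lax N k x = localLax (siteHom N k) x := by
  have h₀ (c : ℂ) (M : Matrix (Fin 2) (Fin 2) ℂ) : x • (1 : Module.End ℂ (QState N)) +
      c • siteOp N k M = siteHom N k (x • 1 + c • M) := by
    rw [map_add, map_smul, map_smul, map_one, siteHom_apply]
  have h₁ (c : ℂ) (M : Matrix (Fin 2) (Fin 2) ℂ) : c • siteOp N k M = siteHom N k (c • M) := by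
    rw [map_smul, siteHom_apply]
  have h₂ : x • (1 : Module.End ℂ (QState N)) - (Complex.I / 2) • siteOp N k pauliZ =
      x • (1 : Module.End ℂ (QState N)) + (-(Complex.I / 2)) • siteOp N k pauliZ := by
    rw [neg_smul (Complex.I / 2) (siteOp N k pauliZ)]
    exact sub_eq_add_neg (G := Module.End ℂ (QState N)) _ _
  unfold lax
  rw [h₂, h₀, h₀, h₁, h₁]
  ext1 i j
  rw [localLax_apply]
  fin_cases i <;> fin_cases j <;> refine congrArg (siteHom N k) ?_ <;> ext a b <;>
    fin_cases a <;> fin_cases b <;>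
    simp [laxEntry, pauliX, pauliY, pauliZ, pauliMinus, pauliPlus] <;> ring

theorem transfer_eq (N : ℕ) (x : ℂ) :
    transfer N x = localTransfer (siteHom N) (List.finRange N).reverse x := by
  simp only [transfer, localTransfer, List.ofFn_eq_map, List.map_reverse, lax_eq]

theorem spinPlus_eq (N : ℕ) :
    spinPlus N = ∑ k : Fin N, siteHom N k (Matrix.single 0 1 1) := by
  simp only [spinPlus, spin, ← siteHom_apply, smul_sum, ← map_smul, ← sum_add_distrib, ← map_add]
  refine sum_congr rfl fun k _ => congrArg _ ?_
  ext a b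
  fin_cases a <;> fin_cases b <;> simp [pauliX, pauliY]
  · linear_combination (-1 / 2 : ℂ) * Complex.I_sq
  · linear_combination (1 / 2 : ℂ) * Complex.I_sq

/-- Bethe vectors for solutions of the Bethe ansatz equations with pairwise distinct
roots are highest weight vectors: `S^+ Ψ_N(λ_1, …, λ_ℓ) = 0`. -/
theorem spinPlus_betheVec (N : ℕ) (hN : 2 ≤ N) {ℓ : ℕ} (lam : Fin ℓ → ℂ)
    (hdist : Function.Injective lam)
    (hreg : ∀ k, lam k ≠ Complex.I / 2)
    (hBAE : ∀ k, ((lam k + Complex.I / 2) / (lam k - Complex.I / 2)) ^ N =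
      ∏ j ∈ Finset.univ.erase k,
        (lam k - lam j + Complex.I) / (lam k - lam j - Complex.I)) :
    spinPlus N (betheVec N lam) = 0 := by
  have hl := List.nodup_reverse.2 (List.nodup_finRange N)
  have hlen : (List.finRange N).reverse.length = N := by simp
  simp only [betheVec, Bop, spinPlus_eq, transfer_eq]
  exact raising_betheVec_eq_zero (fun _ _ h => commute_siteHom h) siteHom_vacuum hl
    (by omega) hdist hreg (by rwa [hlen])

end Heisenberg
end
end
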